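/- Haystack model, inlier bound: Fix d, m₁ ≥ 1 and ℓ ≥ 1, and let z₁,…,z_{m₁} be independent random vectors in ℝ^d, each with independent Gaussian coordinates of mean 0 and variance 1/d (i.e., each zᵢ ~ N(0, (1/d)I_d)). Define the random variable c = (1/m₁)·inf{ ∑_{i=1}^{m₁} ‖Dᵀzᵢ‖₂ : D ∈ ℝ^{d×ℓ}, ‖D‖_F = 1 }. Then for every c₁ > 0, the probability that c ≥ √(2/(dπ)) − √(8ℓ/m₁) − c₁/√m₁ is at least 1 − 2·exp(−c₁²d/2). -/

import Mathlib

open Matrix MeasureTheory ProbabilityTheory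

noncomputable section

/-- Frobenius norm of a real matrix. -/
def fnorm {n r : ℕ} (A : Matrix (Fin n) (Fin r) ℝ) : ℝ :=
  Real.sqrt ((Aᵀ * A).trace)

/-- Euclidean norm of a vector. -/
def vnorm {k : ℕ} (v : Fin k → ℝ) : ℝ := Real.sqrt (∑ i, v i ^ 2)

/-- Law of a random vector in ℝᵏ with independent N(0, σ²) coordinates. -/
def gaussianVec (k : ℕ) (σ2 : NNReal) : Measure (Fin k → ℝ) :=
  Measure.pi fun _ : Fin k => gaussianReal 0 σ2

lemma abs_ciSup_le {ι : Type*} [Nonempty ι] {f : ι → ℝ} {r : ℝ} (h : ∀ i, |f i| ≤ r) :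
    |⨆ i, f i| ≤ r := by
  have hb : BddAbove (Set.range f) := ⟨r, by rintro _ ⟨i, rfl⟩; exact (abs_le.1 (h i)).2⟩
  obtain ⟨i⟩ := ‹Nonempty ι›
  have : Nonempty ι := ⟨i⟩
  exact abs_le.2 ⟨(abs_le.1 (h i)).1.trans (le_ciSup hb i), ciSup_le fun i => (abs_le.1 (h i)).2⟩

lemma bddAbove_range_of_abs_le {ι : Type*} {f : ι → ℝ} {r : ℝ} (h : ∀ i, |f i| ≤ r) :
    BddAbove (Set.range f) :=
  ⟨r, by rintro _ ⟨i, rfl⟩; exact (abs_le.1 (h i)).2⟩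

lemma measurePreserving_finCons {X : Type*} [MeasurableSpace X] (P : Measure X) [SigmaFinite P]
    (n : ℕ) :
    MeasurePreserving (fun p : X × (Fin n → X) => (Fin.cons p.1 p.2 : Fin (n + 1) → X))
      (P.prod (Measure.pi fun _ => P)) (Measure.pi fun _ => P) := by
  have := (measurePreserving_piFinSuccAbove (fun _ : Fin (n + 1) => P) 0).symm
  simpa [MeasurableEquiv.piFinSuccAbove_symm_apply, Fin.insertNthEquiv] using this

lemma integral_pi_succ {X : Type*} [MeasurableSpace X] (P : Measure X) [SigmaFinite P] {n : ℕ}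
    {f : (Fin (n + 1) → X) → ℝ} (hf : Integrable f (Measure.pi fun _ => P)) :
    ∫ z, f z ∂(Measure.pi fun _ => P) =
      ∫ x, ∫ z, f (Fin.cons x z) ∂(Measure.pi fun _ => P) ∂P := by
  have h := measurePreserving_finCons P n
  rw [← h.map_eq, integral_map h.measurable.aemeasurable (by rw [h.map_eq]; exact hf.1)]
  exact integral_prod _ (h.integrable_comp_of_integrable hf)

/-- The supremum over the index `i` of the random walk with steps `Φ i (z k)` started at `R i`. -/
def supWalk {ι X : Type*} (Φ : ι → X → ℝ) (R : ι → ℝ) {n : ℕ} (z : Fin n → X) : ℝ :=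
  ⨆ i, (R i + ∑ k, Φ i (z k))

section supWalk

variable {ι X : Type*} {Φ : ι → X → ℝ} {R : ι → ℝ} {B : X → ℝ} {r : ℝ}

lemma supWalk_zero (z : Fin 0 → X) : supWalk Φ R z = ⨆ i, R i := by simp [supWalk]

lemma supWalk_cons {n : ℕ} (x : X) (z : Fin n → X) :
    supWalk Φ R (Fin.cons x z : Fin (n + 1) → X) = supWalk Φ (fun i => R i + Φ i x) z := by
  simp [supWalk, Fin.sum_univ_succ, add_assoc]

lemma abs_add_sum_le (hΦ : ∀ i x, |Φ i x| ≤ B x) (hR : ∀ i, |R i| ≤ r) {n : ℕ} (z : Fin n → X)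
    (i : ι) : |R i + ∑ k, Φ i (z k)| ≤ r + ∑ k, B (z k) :=
  (abs_add_le _ _).trans <| add_le_add (hR i) <|
    (Finset.abs_sum_le_sum_abs _ _).trans (Finset.sum_le_sum fun k _ => hΦ i (z k))

lemma abs_supWalk_le [Nonempty ι] (hΦ : ∀ i x, |Φ i x| ≤ B x) (hR : ∀ i, |R i| ≤ r) {n : ℕ}
    (z : Fin n → X) : |supWalk Φ R z| ≤ r + ∑ k, B (z k) :=
  abs_ciSup_le (abs_add_sum_le hΦ hR z)

variable [MeasurableSpace X]

lemma measurable_supWalk [Countable ι] (hm : ∀ i, Measurable (Φ i)) {n : ℕ} :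
    Measurable (supWalk Φ R : (Fin n → X) → ℝ) := by
  refine Measurable.iSup fun i => ?_
  have := hm i
  fun_prop

lemma integrable_sum_eval {P : Measure X} [IsProbabilityMeasure P] {B : X → ℝ}
    (hB : Integrable B P) (n : ℕ) :
    Integrable (fun z : Fin n → X => ∑ k, B (z k)) (Measure.pi fun _ => P) :=
  integrable_finsetSum _ fun k _ =>
    (measurePreserving_eval (fun _ : Fin n => P) k).integrable_comp_of_integrable hB

lemma integrable_supWalk [Countable ι] [Nonempty ι] {P : Measure X} [IsProbabilityMeasure P]
    (hm : ∀ i, Measurable (Φ i)) (hB : Integrable B P) (hΦ : ∀ i x, |Φ i x| ≤ B x)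
    (hR : ∀ i, |R i| ≤ r) (n : ℕ) :
    Integrable (supWalk Φ R : (Fin n → X) → ℝ) (Measure.pi fun _ => P) :=
  ((integrable_const r).add (integrable_sum_eval hB n)).mono'
    (measurable_supWalk hm).aestronglyMeasurable
    (.of_forall fun z => abs_supWalk_le hΦ hR z)

/-- Comparison of expected suprema: replacing the steps one at a time. -/
theorem integral_supWalk_mono [Countable ι] [Nonempty ι] {Y : Type*} [MeasurableSpace Y]
    {P : Measure X} [IsProbabilityMeasure P] {Q : Measure Y} [IsProbabilityMeasure Q]
    {Ψ : ι → Y → ℝ} {C : Y → ℝ} (hm : ∀ i, Measurable (Φ i)) (hm' : ∀ i, Measurable (Ψ i))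
    (hB : Integrable B P) (hC : Integrable C Q)
    (hΦ : ∀ i x, |Φ i x| ≤ B x) (hΨ : ∀ i y, |Ψ i y| ≤ C y)
    (step : ∀ (R : ι → ℝ) (r : ℝ), (∀ i, |R i| ≤ r) →
      ∫ x, (⨆ i, (R i + Φ i x)) ∂P ≤ ∫ y, (⨆ i, (R i + Ψ i y)) ∂Q)
    (n : ℕ) (R : ι → ℝ) (r : ℝ) (hR : ∀ i, |R i| ≤ r) :
    ∫ z, supWalk Φ R z ∂(Measure.pi fun _ : Fin n => P) ≤
      ∫ z, supWalk Ψ R z ∂(Measure.pi fun _ : Fin n => Q) := by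
  induction n generalizing R r with
  | zero => simp [supWalk_zero]
  | succ n ih =>
    have hRx : ∀ x i, |R i + Φ i x| ≤ r + B x := fun x i =>
      (abs_add_le _ _).trans (add_le_add (hR i) (hΦ i x))
    have hRy : ∀ w : Fin n → Y, ∀ i, |R i + ∑ k, Ψ i (w k)| ≤ r + ∑ k, C (w k) :=
      fun w i => abs_add_sum_le hΨ hR w i
    have hI := integrable_supWalk hm hB hΦ hR (n + 1)
    have hJ := integrable_supWalk hm' hC hΨ hR (n + 1)
    have hI' := (measurePreserving_finCons P n).integrable_comp_of_integrable hI
    have hJ' := (measurePreserving_finCons Q n).integrable_comp_of_integrable hJ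
    have hmix : Integrable
        (fun p : X × (Fin n → Y) => supWalk Ψ (fun i => R i + Φ i p.1) p.2)
        (P.prod (Measure.pi fun _ => Q)) := by
      refine Integrable.mono' (g := fun p => (r + B p.1) + ∑ k, C (p.2 k))
        (((integrable_const r).add hB).comp_fst _ |>.add ((integrable_sum_eval hC n).comp_snd _))
        ?_ (.of_forall fun p => abs_supWalk_le hΨ (hRx p.1) p.2)
      refine (Measurable.iSup fun i => ?_).aestronglyMeasurable
      have := hm i
      have := hm' i
      fun_prop
    rw [integral_pi_succ P hI, integral_pi_succ Q hJ]
    simp only [supWalk_cons]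
    have hI'' := hI'.integral_prod_left
    simp only [Function.comp_apply, supWalk_cons] at hI''
    calc ∫ x, ∫ z, supWalk Φ (fun i => R i + Φ i x) z ∂(Measure.pi fun _ => P) ∂P
        ≤ ∫ x, ∫ w, supWalk Ψ (fun i => R i + Φ i x) w ∂(Measure.pi fun _ => Q) ∂P :=
          integral_mono hI'' hmix.integral_prod_left fun x => ih _ _ (hRx x)
      _ = ∫ w, ∫ x, supWalk Ψ (fun i => R i + Φ i x) w ∂P ∂(Measure.pi fun _ => Q) :=
          integral_integral_swap hmix
      _ ≤ ∫ w, ∫ y, supWalk Ψ (fun i => R i + Ψ i y) w ∂Q ∂(Measure.pi fun _ => Q) := by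
          refine integral_mono hmix.integral_prod_right ?_ fun w => ?_
          · simpa only [Function.comp_apply, supWalk_cons] using hJ'.integral_prod_right
          · have := step _ _ (hRy w)
            simpa only [supWalk, add_right_comm] using this
      _ = ∫ y, ∫ w, supWalk Ψ (fun i => R i + Ψ i y) w ∂(Measure.pi fun _ => Q) ∂Q := by
          refine (integral_integral_swap ?_).symm
          simpa only [Function.comp_def, supWalk_cons, Function.uncurry_def] using hJ'

lemma exp_neg_le_quadratic {x : ℝ} (hx : 0 ≤ x) : Real.exp (-x) ≤ 1 - x + x ^ 2 / 2 := by
  have h := Real.quadratic_le_exp_of_nonneg hx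
  rw [Real.exp_neg, inv_le_iff_one_le_mul₀ (Real.exp_pos x)]
  have h0 : 0 ≤ 1 - x + x ^ 2 / 2 := by nlinarith [sq_nonneg (x - 1)]
  nlinarith [mul_le_mul_of_nonneg_left h h0, sq_nonneg (x ^ 2)]

/-- A random variable below a constant `c` has a sub-Gaussian upper tail, with variance proxy
its second moment around `c`. -/
lemma integral_exp_le_of_le_const {P : Measure X} [IsProbabilityMeasure P] {h : X → ℝ} {c v s : ℝ}
    (hs : 0 ≤ s) (hle : ∀ x, h x ≤ c) (hi : Integrable h P)
    (hi2 : Integrable (fun x => (c - h x) ^ 2) P) (hv : ∫ x, (c - h x) ^ 2 ∂P ≤ v) :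
    ∫ x, Real.exp (s * h x) ∂P ≤ Real.exp (s * ∫ x, h x ∂P + s ^ 2 * v / 2) := by
  have hpt : ∀ x, Real.exp (s * h x) ≤
      Real.exp (s * c) * (1 - s * (c - h x) + s ^ 2 / 2 * (c - h x) ^ 2) := fun x => by
    have := exp_neg_le_quadratic (mul_nonneg hs (sub_nonneg.2 (hle x)))
    calc Real.exp (s * h x) = Real.exp (s * c) * Real.exp (-(s * (c - h x))) := by
          rw [← Real.exp_add]; ring_nf
      _ ≤ _ := by
          gcongr
          linarith
  have i1 : Integrable (fun x => s * (c - h x)) P := ((integrable_const c).sub hi).const_mul s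
  have i2 : Integrable (fun x => 1 - s * (c - h x)) P := (integrable_const 1).sub i1
  have i3 : Integrable (fun x => s ^ 2 / 2 * (c - h x) ^ 2) P := hi2.const_mul _
  have hg : Integrable (fun x =>
      Real.exp (s * c) * (1 - s * (c - h x) + s ^ 2 / 2 * (c - h x) ^ 2)) P :=
    (i2.add i3).const_mul _
  calc ∫ x, Real.exp (s * h x) ∂P
      ≤ ∫ x, Real.exp (s * c) * (1 - s * (c - h x) + s ^ 2 / 2 * (c - h x) ^ 2) ∂P :=
        integral_mono_of_nonneg (.of_forall fun x => (Real.exp_pos _).le) hg (.of_forall hpt)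
    _ = Real.exp (s * c) * (1 - s * (c - ∫ x, h x ∂P) + s ^ 2 / 2 * ∫ x, (c - h x) ^ 2 ∂P) := by
        rw [integral_const_mul, integral_add i2 i3, integral_sub (integrable_const _) i1,
          integral_const_mul, integral_const_mul, integral_sub (integrable_const _) hi]
        simp
    _ ≤ Real.exp (s * c) * Real.exp (-s * (c - ∫ x, h x ∂P) + s ^ 2 / 2 * v) := by
        gcongr
        refine le_trans ?_ (Real.add_one_le_exp _)
        have := mul_le_mul_of_nonneg_left hv (by positivity : 0 ≤ s ^ 2 / 2)
        linarith
    _ = _ := by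
        rw [← Real.exp_add]
        ring_nf

lemma sq_integral_le_integral_sq {P : Measure X} [IsProbabilityMeasure P] {f : X → ℝ}
    (hf : Integrable f P) (hf2 : Integrable (fun x => f x ^ 2) P) :
    (∫ x, f x ∂P) ^ 2 ≤ ∫ x, f x ^ 2 ∂P := by
  have h : 0 ≤ ∫ x, (f x - ∫ y, f y ∂P) ^ 2 ∂P := integral_nonneg fun x => sq_nonneg _
  have e : ∀ x, (f x - ∫ y, f y ∂P) ^ 2 =
      f x ^ 2 - 2 * (∫ y, f y ∂P) * f x + (∫ y, f y ∂P) ^ 2 := fun x => by ring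
  simp only [e] at h
  have h2 : Integrable (fun x => f x ^ 2 - 2 * (∫ y, f y ∂P) * f x) P :=
    hf2.sub (hf.const_mul _)
  rw [integral_add h2 (integrable_const _),
    integral_sub hf2 (hf.const_mul _), integral_const_mul] at h
  simp at h
  nlinarith

/-- Dropping the supremum of `R` by a nonnegative random perturbation whose individual second
moments are at most `v` costs at most `v` in second moment. -/
lemma integral_sq_sub_iSup_le [Countable ι] [Nonempty ι] {P : Measure X} [IsProbabilityMeasure P]
    {N : ι → X → ℝ} {v : ℝ}
    (hm : ∀ i, Measurable (N i)) (hB : Integrable B P) (hB2 : Integrable (fun x => B x ^ 2) P)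
    (hN0 : ∀ i x, 0 ≤ N i x) (hN : ∀ i x, N i x ≤ B x) (hv : ∀ i, ∫ x, N i x ^ 2 ∂P ≤ v)
    (hR : ∀ i, |R i| ≤ r) :
    ∫ x, ((⨆ i, R i) - ⨆ i, (R i - N i x)) ^ 2 ∂P ≤ v := by
  have hbR := bddAbove_range_of_abs_le hR
  have hb : ∀ x, BddAbove (Set.range fun i => R i - N i x) := fun x =>
    ⟨r, by rintro _ ⟨i, rfl⟩; have := (abs_le.1 (hR i)).2; have := hN0 i x; dsimp only; linarith⟩
  refine le_of_forall_pos_le_add fun δ hδ => ?_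
  set b := ∫ x, B x ∂P
  have hb0 : 0 ≤ b := integral_nonneg fun x =>
    (hN0 (Classical.arbitrary ι) x).trans (hN _ x)
  obtain ⟨ε, hε, hε1, hε2⟩ : ∃ ε : ℝ, 0 < ε ∧ ε ≤ 1 ∧ ε * (2 * b + 1) ≤ δ := by
    refine ⟨min 1 (δ / (2 * b + 1)), by positivity, min_le_left _ _, ?_⟩
    rw [← le_div_iff₀ (by positivity)]
    exact min_le_right _ _
  obtain ⟨i, hi⟩ := exists_lt_of_lt_ciSup (sub_lt_self (⨆ i, R i) hε)
  have iN : Integrable (N i) P := hB.mono' (hm i).aestronglyMeasurable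
    (.of_forall fun x => by rw [Real.norm_of_nonneg (hN0 i x)]; exact hN i x)
  have iN2 : Integrable (fun x => N i x ^ 2) P :=
    hB2.mono' ((hm i).pow_const 2).aestronglyMeasurable
      (.of_forall fun x => by
        rw [Real.norm_of_nonneg (sq_nonneg _)]
        exact pow_le_pow_left₀ (hN0 i x) (hN i x) 2)
  have iS : Integrable (fun x => N i x ^ 2 + 2 * ε * N i x) P := iN2.add (iN.const_mul _)
  calc ∫ x, ((⨆ i, R i) - ⨆ i, (R i - N i x)) ^ 2 ∂P
      ≤ ∫ x, (N i x ^ 2 + 2 * ε * N i x + ε ^ 2) ∂P := by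
        refine integral_mono_of_nonneg (.of_forall fun x => sq_nonneg _)
          (iS.add (integrable_const _)) (.of_forall fun x => ?_)
        have h1 : ⨆ i, (R i - N i x) ≤ ⨆ i, R i :=
          ciSup_mono hbR fun i => sub_le_self _ (hN0 i x)
        have h2 := le_ciSup (hb x) i
        have h3 : ((⨆ i, R i) - ⨆ i, (R i - N i x)) ^ 2 ≤ (N i x + ε) ^ 2 :=
          pow_le_pow_left₀ (sub_nonneg.2 h1) (by linarith) 2
        dsimp only
        linarith
    _ = ∫ x, N i x ^ 2 ∂P + 2 * ε * ∫ x, N i x ∂P + ε ^ 2 := by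
        rw [integral_add iS (integrable_const _),
          integral_add iN2 (iN.const_mul _), integral_const_mul]
        simp
    _ ≤ v + δ := by
        have h1 : ∫ x, N i x ∂P ≤ b := integral_mono iN hB (hN i)
        nlinarith [hv i]

/-- Sub-Gaussian bound for the exponential moments of the supremum of a family of walks with
nonpositive steps. -/
theorem integral_exp_supWalk_le [Countable ι] [Nonempty ι] {P : Measure X} [IsProbabilityMeasure P]
    {N : ι → X → ℝ} {v s : ℝ} (hs : 0 ≤ s)
    (hm : ∀ i, Measurable (N i))
    (hB : Integrable B P) (hB2 : Integrable (fun x => B x ^ 2) P)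
    (hN0 : ∀ i x, 0 ≤ N i x) (hN : ∀ i x, N i x ≤ B x) (hv : ∀ i, ∫ x, N i x ^ 2 ∂P ≤ v)
    (n : ℕ) (R : ι → ℝ) (r : ℝ) (hR : ∀ i, |R i| ≤ r) :
    ∫ z, Real.exp (s * supWalk (fun i x => -N i x) R z) ∂(Measure.pi fun _ : Fin n => P) ≤
      Real.exp (s * ∫ z, supWalk (fun i x => -N i x) R z ∂(Measure.pi fun _ : Fin n => P)
        + n * (s ^ 2 * v / 2)) := by
  induction n generalizing R r with
  | zero => simp [supWalk_zero]
  | succ n ih =>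
    have hΦm : ∀ i, Measurable (fun x => -N i x) := fun i => (hm i).neg
    have hΦ : ∀ i x, |(-N i x)| ≤ B x := fun i x => by
      rw [abs_neg, abs_of_nonneg (hN0 i x)]; exact hN i x
    have hRx : ∀ x i, |R i + -N i x| ≤ r + B x := fun x i =>
      (abs_add_le _ _).trans (add_le_add (hR i) (hΦ i x))
    have hI := integrable_supWalk hΦm hB hΦ hR (n + 1)
    have hI0 := integrable_supWalk hΦm hB hΦ hR n
    have hI' := (measurePreserving_finCons P n).integrable_comp_of_integrable hI
    simp only [Function.comp_def, supWalk_cons] at hI'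
    have hub : ∀ (m : ℕ) (z : Fin m → X), supWalk (fun i x => -N i x) R z ≤ r := fun m z =>
      ciSup_le fun i => by
        have h1 := (abs_le.1 (hR i)).2
        have h2 : ∑ k, -N i (z k) ≤ 0 := Finset.sum_nonpos fun k _ => by
          have := hN0 i (z k); linarith
        linarith
    have hE : Integrable (fun z : Fin (n + 1) → X =>
        Real.exp (s * supWalk (fun i x => -N i x) R z)) (Measure.pi fun _ => P) := by
      refine (integrable_const (Real.exp (s * r))).mono'
        ((measurable_supWalk hΦm).const_mul s).exp.aestronglyMeasurable (.of_forall fun z => ?_)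
      rw [Real.norm_of_nonneg (Real.exp_pos _).le]
      exact Real.exp_le_exp.2 (mul_le_mul_of_nonneg_left (hub _ z) hs)
    have hE' := ((measurePreserving_finCons P n).integrable_comp_of_integrable hE).integral_prod_left
    simp only [Function.comp_def, supWalk_cons] at hE'
    rw [integral_pi_succ P hI, integral_pi_succ P hE]
    simp only [supWalk_cons]
    set π := Measure.pi fun _ : Fin n => P
    set W : X → (Fin n → X) → ℝ := fun x z => supWalk (fun i x => -N i x) (fun i => R i + -N i x) z
    set W₀ : (Fin n → X) → ℝ := fun z => supWalk (fun i x => -N i x) R z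
    set h : X → ℝ := fun x => ∫ z, W x z ∂π with hh
    set c := ∫ z, W₀ z ∂π
    have hWi : ∀ x, Integrable (W x) π := fun x => integrable_supWalk hΦm hB hΦ (hRx x) n
    have hWW₀ : ∀ x z, W x z ≤ W₀ z := fun x z =>
      ciSup_mono (bddAbove_range_of_abs_le (abs_add_sum_le hΦ hR z)) fun i => by
        have := hN0 i x; dsimp only; linarith
    have hW₀W : ∀ x z, W₀ z - W x z ≤ B x := fun x z => by
      rw [sub_le_iff_le_add]
      refine ciSup_le fun i => ?_
      have h1 := le_ciSup (bddAbove_range_of_abs_le (abs_add_sum_le hΦ (hRx x) z)) i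
      have h2 := hN i x
      change _ ≤ B x + W x z
      change _ ≤ W x z at h1
      linarith
    have hdiff2 : ∀ x z, (W₀ z - W x z) ^ 2 ≤ B x ^ 2 := fun x z =>
      pow_le_pow_left₀ (sub_nonneg.2 (hWW₀ x z)) (hW₀W x z) 2
    have hdm : Measurable fun p : X × (Fin n → X) => W₀ p.2 - W p.1 p.2 := by
      refine ((measurable_supWalk hΦm).comp measurable_snd).sub (Measurable.iSup fun i => ?_)
      have := hm i
      fun_prop
    have hD : Integrable (fun p : X × (Fin n → X) => (W₀ p.2 - W p.1 p.2) ^ 2) (P.prod π) :=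
      (hB2.comp_fst π).mono' (hdm.pow_const 2).aestronglyMeasurable (.of_forall fun p => by
        rw [Real.norm_of_nonneg (sq_nonneg _)]; exact hdiff2 _ _)
    have hDx : ∀ x, Integrable (fun z => (W₀ z - W x z) ^ 2) π := fun x =>
      (integrable_const (B x ^ 2)).mono'
        ((hdm.comp measurable_prodMk_left).pow_const 2).aestronglyMeasurable
        (.of_forall fun z => by rw [Real.norm_of_nonneg (sq_nonneg _)]; exact hdiff2 _ _)
    have hhi : Integrable h P := hI'.integral_prod_left
    have hch : ∀ x, c - h x = ∫ z, (W₀ z - W x z) ∂π := fun x =>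
      (integral_sub hI0 (hWi x)).symm
    have hsq : ∀ x, (c - h x) ^ 2 ≤ ∫ z, (W₀ z - W x z) ^ 2 ∂π := fun x => by
      rw [hch x]
      exact sq_integral_le_integral_sq (hI0.sub (hWi x)) (hDx x)
    have hsqi : Integrable (fun x => (c - h x) ^ 2) P :=
      hD.integral_prod_left.mono' (((integrable_const c).sub hhi).1.pow 2) (.of_forall fun x => by
        rw [Real.norm_of_nonneg (sq_nonneg _)]; exact hsq x)
    have hvar : ∫ x, (c - h x) ^ 2 ∂P ≤ v := by
      calc ∫ x, (c - h x) ^ 2 ∂P ≤ ∫ x, ∫ z, (W₀ z - W x z) ^ 2 ∂π ∂P :=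
            integral_mono hsqi hD.integral_prod_left hsq
        _ = ∫ z, ∫ x, (W₀ z - W x z) ^ 2 ∂P ∂π := integral_integral_swap hD
        _ ≤ ∫ _, v ∂π := by
            refine integral_mono hD.integral_prod_right (integrable_const v) fun z => ?_
            have := integral_sq_sub_iSup_le hm hB hB2 hN0 hN hv (abs_add_sum_le hΦ hR z)
            refine le_of_eq_of_le ?_ this
            simp only [W₀, W, supWalk, sub_eq_add_neg, add_right_comm]
        _ = v := by simp
    have key := integral_exp_le_of_le_const hs
      (fun x => integral_mono (hWi x) hI0 (hWW₀ x)) hhi hsqi hvar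
    have hexp : ∀ x, ∫ z, Real.exp (s * W x z) ∂π ≤
        Real.exp (s * h x) * Real.exp (n * (s ^ 2 * v / 2)) := fun x => by
      rw [← Real.exp_add]
      exact ih _ _ (hRx x)
    have hci : Integrable (fun x => Real.exp (s * h x)) P := by
      refine (integrable_const (Real.exp (s * c))).mono'
        (Real.continuous_exp.comp_aestronglyMeasurable (hhi.1.const_mul s))
        (.of_forall fun x => ?_)
      rw [Real.norm_of_nonneg (Real.exp_pos _).le]
      exact Real.exp_le_exp.2
        (mul_le_mul_of_nonneg_left (integral_mono (hWi x) hI0 (hWW₀ x)) hs)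
    calc ∫ x, ∫ z, Real.exp (s * W x z) ∂π ∂P
        ≤ ∫ x, Real.exp (s * h x) * Real.exp (n * (s ^ 2 * v / 2)) ∂P :=
          integral_mono hE' (hci.mul_const _) hexp
      _ ≤ Real.exp (s * ∫ x, h x ∂P + s ^ 2 * v / 2) * Real.exp (n * (s ^ 2 * v / 2)) := by
          rw [integral_mul_const]
          gcongr
      _ = _ := by
          rw [← Real.exp_add]
          push_cast
          ring_nf

end supWalk

instance (k : ℕ) (v : NNReal) : IsProbabilityMeasure (gaussianVec k v) := by
  unfold gaussianVec; infer_instance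

lemma integral_abs_gaussianReal_one : ∫ x, |x| ∂(gaussianReal 0 1) = √(2 / Real.pi) := by
  rw [integral_gaussianReal_eq_integral_smul one_ne_zero]
  have h1 : ∀ x : ℝ, gaussianPDFReal 0 1 x • |x| =
      (fun y : ℝ => (√(2 * Real.pi))⁻¹ * (y ^ (1 : ℝ) * Real.exp (-(1 / 2) * y ^ (2 : ℝ)))) |x| :=
    fun x => by
      simp only [gaussianPDFReal, Real.rpow_one, Real.rpow_two, sq_abs, smul_eq_mul]
      simp
      ring_nf
  rw [integral_congr_ae (.of_forall h1),
    integral_comp_abs (f := fun y : ℝ =>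
      (√(2 * Real.pi))⁻¹ * (y ^ (1 : ℝ) * Real.exp (-(1 / 2) * y ^ (2 : ℝ)))),
    integral_const_mul,
    integral_rpow_mul_exp_neg_mul_rpow two_pos (by norm_num) (by norm_num)]
  norm_num
  have hp := Real.pi_pos
  have h2 : (√2) ^ 2 = 2 := Real.sq_sqrt (by norm_num)
  have : √2 ≠ 0 := by positivity
  have : √Real.pi ≠ 0 := by positivity
  field_simp
  linarith

lemma integral_abs_gaussianReal (v : NNReal) :
    ∫ x, |x| ∂(gaussianReal 0 v) = √(2 / Real.pi) * √v := by
  have h := gaussianReal_map_const_mul (μ := 0) (v := 1) (√(v : ℝ))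
  have h' : NNReal.mk (√(v : ℝ) ^ 2) (sq_nonneg _) * 1 = v := by
    ext; simp
  rw [mul_zero, h'] at h
  rw [← h, integral_map (by fun_prop) (by fun_prop)]
  simp_rw [abs_mul]
  rw [integral_const_mul, integral_abs_gaussianReal_one,
    abs_of_nonneg (Real.sqrt_nonneg _), mul_comm]

lemma gaussianVec_map_dotProduct {k : ℕ} (v : NNReal) (a : Fin k → ℝ) :
    (gaussianVec k v).map (fun x => a ⬝ᵥ x) =
      gaussianReal 0 (∑ i, NNReal.mk (a i ^ 2) (sq_nonneg _) * v) := by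
  have hind : iIndepFun (fun i (x : Fin k → ℝ) => a i * x i) (gaussianVec k v) :=
    iIndepFun_pi (X := fun i (t : ℝ) => a i * t) fun i => by fun_prop
  have hlaw : ∀ i, (gaussianVec k v).map (fun x => a i * x i) =
      gaussianReal 0 (NNReal.mk (a i ^ 2) (sq_nonneg _) * v) := fun i => by
    have h1 : (gaussianVec k v).map (fun x => x i) = gaussianReal 0 v :=
      (measurePreserving_eval (fun _ : Fin k => gaussianReal 0 v) i).map_eq
    have h2 := gaussianReal_map_const_mul (μ := 0) (v := v) (a i)
    rw [mul_zero, ← h1, Measure.map_map (by fun_prop) (by fun_prop)] at h2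
    exact h2
  have : ∀ s : Finset (Fin k), (gaussianVec k v).map (∑ i ∈ s, fun x => a i * x i) =
      gaussianReal 0 (∑ i ∈ s, NNReal.mk (a i ^ 2) (sq_nonneg _) * v) := fun s => by
    induction s using Finset.induction_on with
    | empty =>
      simp only [Finset.sum_empty, gaussianReal_zero_var]
      exact (Measure.map_const _ _).trans (by rw [measure_univ, one_smul]; rfl)
    | insert i s hi ih =>
      rw [Finset.sum_insert hi, Finset.sum_insert hi]
      have := gaussianReal_add_gaussianReal_of_indepFun
        (hind.indepFun_finsetSum_of_notMem (fun i => by fun_prop) hi).symm (hlaw i) ih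
      rw [add_zero] at this
      exact this
  convert this Finset.univ using 2
  ext x
  simp [dotProduct]

lemma integral_abs_dotProduct_gaussianVec {k : ℕ} (v : NNReal) (a : Fin k → ℝ) :
    ∫ x, |a ⬝ᵥ x| ∂(gaussianVec k v) = √(2 / Real.pi) * √v * vnorm a := by
  have h : ∫ x, |a ⬝ᵥ x| ∂(gaussianVec k v) =
      ∫ y, |y| ∂((gaussianVec k v).map fun x => a ⬝ᵥ x) :=
    (integral_map (Measurable.aemeasurable (by unfold dotProduct; fun_prop)) (by fun_prop)).symm
  rw [h, gaussianVec_map_dotProduct, integral_abs_gaussianReal, ← Finset.sum_mul]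
  have h2 : (((∑ i, NNReal.mk (a i ^ 2) (sq_nonneg _)) * v : NNReal) : ℝ) = v * ∑ i, a i ^ 2 := by
    push_cast
    rw [mul_comm]
  rw [h2, Real.sqrt_mul v.coe_nonneg, vnorm, mul_assoc]

lemma integral_eval_sq_gaussianVec {k : ℕ} (v : NNReal) (i : Fin k) :
    Integrable (fun x => x i ^ 2) (gaussianVec k v) ∧ ∫ x, x i ^ 2 ∂(gaussianVec k v) = v := by
  have h := measurePreserving_eval (fun _ : Fin k => gaussianReal 0 v) i
  have h2 : Integrable (fun x : ℝ => x ^ 2) (gaussianReal 0 v) :=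
    (memLp_id_gaussianReal 2).integrable_sq
  refine ⟨h.integrable_comp_of_integrable h2, ?_⟩
  have h3 : ∫ x, x i ^ 2 ∂(gaussianVec k v) = ∫ y, y ^ 2 ∂(gaussianReal 0 v) := by
    rw [← h.map_eq, integral_map h.aemeasurable (by fun_prop)]; rfl
  have h4 := variance_eq_sub (memLp_id_gaussianReal (μ := 0) (v := v) 2)
  rw [variance_id_gaussianReal] at h4
  simp [integral_id_gaussianReal] at h4
  rw [h3, h4]

lemma integral_eval_gaussianVec {k : ℕ} (v : NNReal) (i : Fin k) :
    ∫ x, x i ∂(gaussianVec k v) = 0 := by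
  have h := measurePreserving_eval (fun _ : Fin k => gaussianReal 0 v) i
  have h3 : ∫ x, x i ∂(gaussianVec k v) = ∫ y, y ∂(gaussianReal 0 v) := by
    rw [← h.map_eq, integral_map h.aemeasurable (by fun_prop)]; rfl
  rw [h3, integral_id_gaussianReal]

lemma measurePreserving_neg_gaussianVec (k : ℕ) (v : NNReal) :
    MeasurePreserving (fun x => -x) (gaussianVec k v) (gaussianVec k v) := by
  refine measurePreserving_pi _ _ (f := fun _ t => -t) fun i => ⟨measurable_neg, ?_⟩
  simpa using gaussianReal_map_neg (μ := 0) (v := v)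

lemma integral_vnorm_sq_gaussianVec (k : ℕ) (v : NNReal) :
    Integrable (fun x => vnorm x ^ 2) (gaussianVec k v) ∧
      ∫ x, vnorm x ^ 2 ∂(gaussianVec k v) = k * v := by
  have h : ∀ x : Fin k → ℝ, vnorm x ^ 2 = ∑ i, x i ^ 2 := fun x => Real.sq_sqrt (by positivity)
  simp_rw [h]
  refine ⟨integrable_finsetSum _ fun i _ => (integral_eval_sq_gaussianVec v i).1, ?_⟩
  rw [integral_finsetSum _ fun i _ => (integral_eval_sq_gaussianVec v i).1]
  simp [(integral_eval_sq_gaussianVec v _).2]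

lemma memLp_dotProduct_gaussianVec {k : ℕ} (v : NNReal) (a : Fin k → ℝ) :
    Integrable (fun x => a ⬝ᵥ x) (gaussianVec k v) ∧
    Integrable (fun x => (a ⬝ᵥ x) ^ 2) (gaussianVec k v) ∧
      ∫ x, (a ⬝ᵥ x) ^ 2 ∂(gaussianVec k v) = v * ∑ i, a i ^ 2 := by
  have h : MeasurePreserving (fun x => a ⬝ᵥ x) (gaussianVec k v) _ :=
    ⟨by unfold dotProduct; fun_prop, gaussianVec_map_dotProduct v a⟩
  set w := ∑ i, NNReal.mk (a i ^ 2) (sq_nonneg _) * v with hw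
  have h2 : Integrable (fun x : ℝ => x ^ 2) (gaussianReal 0 w) :=
    (memLp_id_gaussianReal 2).integrable_sq
  have h1 : Integrable (fun x : ℝ => x) (gaussianReal 0 w) :=
    memLp_one_iff_integrable.1 (memLp_id_gaussianReal 1)
  refine ⟨h.integrable_comp_of_integrable h1, h.integrable_comp_of_integrable h2, ?_⟩
  have h3 : ∫ x, (a ⬝ᵥ x) ^ 2 ∂(gaussianVec k v) = ∫ y, y ^ 2 ∂(gaussianReal 0 w) := by
    rw [← h.map_eq, integral_map h.aemeasurable (by fun_prop)]
  have h4 := variance_eq_sub (memLp_id_gaussianReal (μ := 0) (v := w) 2)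
  rw [variance_id_gaussianReal] at h4
  simp [integral_id_gaussianReal] at h4
  rw [h3, ← h4, hw, ← Finset.sum_mul]
  push_cast
  rw [mul_comm]

lemma vnorm_eq_norm {k : ℕ} (v : Fin k → ℝ) : vnorm v = ‖WithLp.toLp 2 v‖ := by
  simp [vnorm, EuclideanSpace.norm_eq]

lemma vnorm_nonneg {k : ℕ} (v : Fin k → ℝ) : 0 ≤ vnorm v := Real.sqrt_nonneg _

lemma vnorm_sq {k : ℕ} (v : Fin k → ℝ) : vnorm v ^ 2 = ∑ i, v i ^ 2 :=
  Real.sq_sqrt (by positivity)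

lemma abs_vnorm_sub_vnorm_le {k : ℕ} (a b : Fin k → ℝ) : |vnorm a - vnorm b| ≤ vnorm (a - b) := by
  simp only [vnorm_eq_norm, WithLp.toLp_sub]
  exact abs_norm_sub_norm_le _ _

lemma continuous_vnorm {k : ℕ} : Continuous (vnorm : (Fin k → ℝ) → ℝ) := by
  unfold vnorm
  fun_prop

lemma abs_dotProduct_le_vnorm_mul {k : ℕ} (a b : Fin k → ℝ) : |a ⬝ᵥ b| ≤ vnorm a * vnorm b := by
  refine abs_le_of_sq_le_sq ?_ (mul_nonneg (vnorm_nonneg _) (vnorm_nonneg _))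
  rw [mul_pow, vnorm_sq, vnorm_sq]
  exact Finset.sum_mul_sq_le_sq_mul_sq _ _ _

lemma fnorm_eq {n r : ℕ} (A : Matrix (Fin n) (Fin r) ℝ) :
    fnorm A = √(∑ k, ∑ j, A j k ^ 2) := by
  simp [fnorm, Matrix.trace, Matrix.mul_apply, sq]

lemma sum_sq_of_fnorm_eq_one {n r : ℕ} {A : Matrix (Fin n) (Fin r) ℝ} (h : fnorm A = 1) :
    ∑ k, ∑ j, A j k ^ 2 = 1 := by
  rwa [fnorm_eq, Real.sqrt_eq_one] at h

lemma transpose_mulVec_apply {n r : ℕ} (A : Matrix (Fin n) (Fin r) ℝ) (x : Fin n → ℝ) (k : Fin r) :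
    (Aᵀ *ᵥ x) k = (fun j => A j k) ⬝ᵥ x := rfl

lemma vnorm_transpose_mulVec_le {n r : ℕ} {A : Matrix (Fin n) (Fin r) ℝ} (h : fnorm A = 1)
    (x : Fin n → ℝ) : vnorm (Aᵀ *ᵥ x) ≤ vnorm x := by
  refine Real.sqrt_le_iff.2 ⟨vnorm_nonneg _, ?_⟩
  calc ∑ k, (Aᵀ *ᵥ x) k ^ 2 ≤ ∑ k, (∑ j, A j k ^ 2) * vnorm x ^ 2 :=
        Finset.sum_le_sum fun k _ => by
          rw [vnorm_sq]
          exact Finset.sum_mul_sq_le_sq_mul_sq Finset.univ (fun j => A j k) x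
    _ = vnorm x ^ 2 := by rw [← Finset.sum_mul, sum_sq_of_fnorm_eq_one h, one_mul]

lemma measurable_vnorm_mulVec {n r : ℕ} (A : Matrix (Fin n) (Fin r) ℝ) :
    Measurable fun x => vnorm (A *ᵥ x) :=
  (continuous_vnorm.comp (Continuous.matrix_mulVec continuous_const continuous_id)).measurable

lemma integral_vnorm_sq_transpose_mulVec {n r : ℕ} (v : NNReal) {A : Matrix (Fin n) (Fin r) ℝ}
    (h : fnorm A = 1) : ∫ x, vnorm (Aᵀ *ᵥ x) ^ 2 ∂(gaussianVec n v) = v := by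
  simp_rw [vnorm_sq, transpose_mulVec_apply]
  rw [integral_finsetSum _ fun k _ => (memLp_dotProduct_gaussianVec v _).2.1]
  simp_rw [(memLp_dotProduct_gaussianVec v _).2.2]
  rw [← Finset.mul_sum, sum_sq_of_fnorm_eq_one h, mul_one]

lemma integrable_vnorm (n : ℕ) (v : NNReal) : Integrable vnorm (gaussianVec n v) := by
  refine MemLp.integrable (q := 2) (by norm_num) ?_
  exact (memLp_two_iff_integrable_sq continuous_vnorm.aestronglyMeasurable).2
    (integral_vnorm_sq_gaussianVec n v).1

lemma integrable_vnorm_transpose_mulVec {n r : ℕ} (v : NNReal) {A : Matrix (Fin n) (Fin r) ℝ}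
    (h : fnorm A = 1) : Integrable (fun x => vnorm (Aᵀ *ᵥ x)) (gaussianVec n v) :=
  (integrable_vnorm n v).mono' (measurable_vnorm_mulVec _).aestronglyMeasurable
    (.of_forall fun x => by
      rw [Real.norm_of_nonneg (vnorm_nonneg _)]; exact vnorm_transpose_mulVec_le h x)

lemma le_integral_vnorm_transpose_mulVec {n r : ℕ} (v : NNReal) {A : Matrix (Fin n) (Fin r) ℝ}
    (h : fnorm A = 1) :
    √(2 / Real.pi) * √v ≤ ∫ x, vnorm (Aᵀ *ᵥ x) ∂(gaussianVec n v) := by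
  set p : Fin r → ℝ := fun k => vnorm fun j => A j k
  have hp : ∑ k, p k ^ 2 = 1 := by
    simp_rw [p, vnorm_sq]
    exact sum_sq_of_fnorm_eq_one h
  have hi : ∀ k, Integrable (fun x => p k * |(fun j => A j k) ⬝ᵥ x|) (gaussianVec n v) :=
    fun k => (memLp_dotProduct_gaussianVec v _).1.abs.const_mul _
  calc √(2 / Real.pi) * √v = ∫ x, ∑ k, p k * |(fun j => A j k) ⬝ᵥ x| ∂(gaussianVec n v) := by
        rw [integral_finsetSum _ fun k _ => hi k]
        simp_rw [integral_const_mul, integral_abs_dotProduct_gaussianVec]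
        calc √(2 / Real.pi) * √v = √(2 / Real.pi) * √v * ∑ k, p k ^ 2 := by rw [hp, mul_one]
          _ = _ := by
            rw [Finset.mul_sum]
            exact Finset.sum_congr rfl fun k _ => by ring
    _ ≤ _ := by
        refine integral_mono (integrable_finsetSum _ fun k _ => hi k)
          (integrable_vnorm_transpose_mulVec v h) fun x => ?_
        refine Real.le_sqrt_of_sq_le ?_
        refine (Finset.sum_mul_sq_le_sq_mul_sq _ _ _).trans_eq ?_
        rw [hp, one_mul]
        simp only [sq_abs, transpose_mulVec_apply]

/-- Symmetrization and Gaussian vector contraction for one summand. -/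
theorem integral_iSup_sub_vnorm_le {ι : Type*} [Countable ι] [Nonempty ι] {d l : ℕ} (v : NNReal)
    (D : ι → Matrix (Fin d) (Fin l) ℝ) (hD : ∀ i, fnorm (D i) = 1) (R : ι → ℝ) (r : ℝ)
    (hR : ∀ i, |R i| ≤ r) :
    ∫ x, (⨆ i, (R i + (∫ y, vnorm ((D i)ᵀ *ᵥ y) ∂(gaussianVec d v) - vnorm ((D i)ᵀ *ᵥ x))))
        ∂(gaussianVec d v) ≤
      ∫ p, (⨆ i, (R i + √(2 * Real.pi) * (((D i)ᵀ *ᵥ p.1) ⬝ᵥ p.2)))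
        ∂((gaussianVec d v).prod (gaussianVec l 1)) := by
  set P := gaussianVec d v
  set G := gaussianVec l 1
  set c := √(2 * Real.pi)
  have hc0 : 0 ≤ c := Real.sqrt_nonneg _
  have hc : c * √(2 / Real.pi) = 2 := by
    rw [← Real.sqrt_mul (by positivity),
      show 2 * Real.pi * (2 / Real.pi) = 2 ^ 2 by field_simp]
    exact Real.sqrt_sq (by norm_num)
  set N : ι → (Fin d → ℝ) → ℝ := fun i x => vnorm ((D i)ᵀ *ᵥ x)
  set μ : ι → ℝ := fun i => ∫ y, N i y ∂P
  set Ψ : ι → (Fin d → ℝ) → (Fin l → ℝ) → ℝ := fun i z g => c * (((D i)ᵀ *ᵥ z) ⬝ᵥ g)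
  set V : (Fin d → ℝ) → (Fin l → ℝ) → ℝ := fun z g => ⨆ i, (R i + Ψ i z g)
  have hNm : ∀ i, Measurable (N i) := fun i => measurable_vnorm_mulVec _
  have hN0 : ∀ i x, 0 ≤ N i x := fun i x => vnorm_nonneg _
  have hNB : ∀ i x, N i x ≤ vnorm x := fun i x => vnorm_transpose_mulVec_le (hD i) x
  have hNi : ∀ i, Integrable (N i) P := fun i => integrable_vnorm_transpose_mulVec v (hD i)
  have hBi : Integrable vnorm P := integrable_vnorm d v
  have hμ : ∀ i, |μ i| ≤ ∫ x, vnorm x ∂P := fun i => by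
    rw [abs_of_nonneg (integral_nonneg (hN0 i))]
    exact integral_mono (hNi i) hBi (hNB i)
  have hΨB : ∀ i z g, |Ψ i z g| ≤ c * (vnorm z * vnorm g) := fun i z g => by
    rw [abs_mul, abs_of_nonneg hc0]
    gcongr
    refine (abs_dotProduct_le_vnorm_mul _ _).trans ?_
    gcongr
    · exact vnorm_nonneg _
    · exact hNB i z
  have hVB : ∀ z g i, |R i + Ψ i z g| ≤ r + c * (vnorm z * vnorm g) := fun z g i =>
    (abs_add_le _ _).trans (add_le_add (hR i) (hΨB i z g))
  have hVbdd := fun z g => bddAbove_range_of_abs_le (hVB z g)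
  have hVm : Measurable fun p : (Fin d → ℝ) × (Fin l → ℝ) => V p.1 p.2 :=
    Measurable.iSup fun i => by
      simp only [Ψ, dotProduct, Matrix.mulVec]
      fun_prop
  have hV : Integrable (fun p : (Fin d → ℝ) × (Fin l → ℝ) => V p.1 p.2) (P.prod G) :=
    ((integrable_const r).add ((hBi.mul_prod (integrable_vnorm l 1)).const_mul c)).mono'
      hVm.aestronglyMeasurable (.of_forall fun p => abs_ciSup_le (hVB p.1 p.2))
  have hVz : ∀ z, Integrable (V z) G := fun z =>
    ((integrable_const r).add (((integrable_vnorm l 1).const_mul (vnorm z)).const_mul c)).mono'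
      (hVm.comp measurable_prodMk_left).aestronglyMeasurable
      (.of_forall fun g => abs_ciSup_le (hVB z g))
  have hneg := measurePreserving_neg_gaussianVec l 1
  have hVz' : ∀ z, Integrable (fun g => V z (-g)) G := fun z =>
    hneg.integrable_comp_of_integrable (hVz z)
  have hVneg : ∀ z, ∫ g, V z (-g) ∂G = ∫ g, V z g ∂G := fun z =>
    hneg.integral_comp (MeasurableEquiv.neg _).measurableEmbedding _
  set A : (Fin d → ℝ) → ℝ := fun z => ∫ g, V z g ∂G
  have hA : Integrable A P := hV.integral_prod_left
  have hRNA : ∀ i j z, R i + R j + 2 * |N i z - N j z| ≤ 2 * A z := fun i j z => by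
    set a := (D i)ᵀ *ᵥ z - (D j)ᵀ *ᵥ z
    have hai : Integrable (fun g => c * |a ⬝ᵥ g|) G :=
      (memLp_dotProduct_gaussianVec 1 a).1.abs.const_mul c
    calc R i + R j + 2 * |N i z - N j z| ≤ R i + R j + 2 * vnorm a := by
          gcongr
          exact abs_vnorm_sub_vnorm_le _ _
      _ = ∫ g, (R i + R j + c * |a ⬝ᵥ g|) ∂G := by
          rw [integral_add (integrable_const _) hai, integral_const_mul,
            integral_abs_dotProduct_gaussianVec]
          rw [← mul_assoc, ← mul_assoc, hc]
          simp
      _ ≤ ∫ g, (V z g + V z (-g)) ∂G := by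
          refine integral_mono ((integrable_const _).add hai) ((hVz z).add (hVz' z)) fun g => ?_
          have e : c * |a ⬝ᵥ g| = |Ψ i z g - Ψ j z g| := by
            simp only [Ψ, a, sub_dotProduct]
            rw [← mul_sub, abs_mul, abs_of_nonneg hc0]
          have hn : ∀ k, Ψ k z (-g) = - Ψ k z g := fun k => by simp [Ψ]
          have b1 : ∀ k, R k + Ψ k z g ≤ V z g := le_ciSup (hVbdd z g)
          have b2 : ∀ k, R k + Ψ k z (-g) ≤ V z (-g) := le_ciSup (hVbdd z (-g))
          have := b1 i
          have := b1 j
          have := b2 i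
          have := b2 j
          rw [hn] at *
          dsimp only
          rw [e]
          cases abs_cases (Ψ i z g - Ψ j z g) <;> linarith
      _ = 2 * A z := by rw [integral_add (hVz z) (hVz' z), hVneg, two_mul]
  set p : (Fin d → ℝ) → (Fin d → ℝ) → ℝ := fun z z' => ⨆ i, (R i + (N i z' - N i z))
  have hpB : ∀ z z' i, |R i + (N i z' - N i z)| ≤ r + (vnorm z' + vnorm z) := fun z z' i => by
    refine (abs_add_le _ _).trans (add_le_add (hR i) ((abs_sub _ _).trans ?_))
    rw [abs_of_nonneg (hN0 i _), abs_of_nonneg (hN0 i _)]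
    exact add_le_add (hNB i _) (hNB i _)
  have hpbdd := fun z z' => bddAbove_range_of_abs_le (hpB z z')
  have hpm : Measurable fun q : (Fin d → ℝ) × (Fin d → ℝ) => p q.1 q.2 :=
    Measurable.iSup fun i => by
      have := hNm i
      fun_prop
  have hp : Integrable (fun q : (Fin d → ℝ) × (Fin d → ℝ) => p q.1 q.2) (P.prod P) :=
    ((integrable_const r).add ((hBi.comp_snd P).add (hBi.comp_fst P))).mono'
      hpm.aestronglyMeasurable (.of_forall fun q => abs_ciSup_le (hpB q.1 q.2))
  have hpz : ∀ z, Integrable (p z) P := fun z =>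
    ((integrable_const r).add (hBi.add (integrable_const _))).mono'
      (hpm.comp measurable_prodMk_left).aestronglyMeasurable
      (.of_forall fun z' => abs_ciSup_le (hpB z z'))
  have hpp : ∀ z z', p z z' + p z' z ≤ A z + A z' := fun z z' => by
    rw [← le_sub_iff_add_le]
    refine ciSup_le fun i => ?_
    rw [le_sub_comm]
    refine ciSup_le fun j => ?_
    have h1 := hRNA i j z
    have h2 := hRNA i j z'
    have h3 := neg_abs_le (N i z - N j z)
    have h4 := le_abs_self (N i z' - N j z')
    linarith
  have hU : ∀ z, (⨆ i, (R i + (μ i - N i z))) ≤ ∫ z', p z z' ∂P := fun z => ciSup_le fun i => by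
    have hNz : Integrable (fun z' => N i z' - N i z) P := (hNi i).sub (integrable_const _)
    calc R i + (μ i - N i z) = ∫ z', (R i + (N i z' - N i z)) ∂P := by
          rw [integral_add (integrable_const _) hNz,
            integral_sub (hNi i) (integrable_const _)]
          simp [μ]
      _ ≤ _ := integral_mono ((integrable_const _).add hNz) (hpz z)
          fun z' => le_ciSup (hpbdd z z') i
  have hUi : Integrable (fun z => ⨆ i, (R i + (μ i - N i z))) P := by
    refine ((integrable_const r).add ((integrable_const (∫ x, vnorm x ∂P)).add hBi)).mono'
      (Measurable.iSup fun i => ?_).aestronglyMeasurable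
      (.of_forall fun z => abs_ciSup_le fun i => ?_)
    · have := hNm i
      fun_prop
    · refine (abs_add_le _ _).trans (add_le_add (hR i) ((abs_sub _ _).trans ?_))
      refine add_le_add (hμ i) ?_
      rw [abs_of_nonneg (hN0 i _)]
      exact hNB i z
  have hswap : ∫ z, ∫ z', p z z' ∂P ∂P = ∫ z, ∫ z', p z' z ∂P ∂P := integral_integral_swap hp
  have hAA : Integrable (fun q : (Fin d → ℝ) × (Fin d → ℝ) => A q.1 + A q.2) (P.prod P) :=
    (hA.comp_fst P).add (hA.comp_snd P)
  have hps : Integrable (fun q : (Fin d → ℝ) × (Fin d → ℝ) => p q.2 q.1) (P.prod P) := hp.swap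
  have h2 : 2 * ∫ z, ∫ z', p z z' ∂P ∂P ≤ 2 * ∫ z, A z ∂P := by
    calc 2 * ∫ z, ∫ z', p z z' ∂P ∂P
        = ∫ q, p q.1 q.2 ∂(P.prod P) + ∫ q, p q.2 q.1 ∂(P.prod P) := by
          rw [integral_prod _ hp, integral_prod _ hps, ← hswap, two_mul]
      _ = ∫ q, (p q.1 q.2 + p q.2 q.1) ∂(P.prod P) := (integral_add hp hps).symm
      _ ≤ ∫ q, (A q.1 + A q.2) ∂(P.prod P) :=
          integral_mono (hp.add hps) hAA fun q => hpp q.1 q.2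
      _ = 2 * ∫ z, A z ∂P := by
          rw [integral_add (hA.comp_fst P) (hA.comp_snd P), integral_fun_fst, integral_fun_snd]
          simp [two_mul]
  calc ∫ z, (⨆ i, (R i + (μ i - N i z))) ∂P ≤ ∫ z, ∫ z', p z z' ∂P ∂P :=
        integral_mono hUi hp.integral_prod_left hU
    _ ≤ ∫ z, A z ∂P := by linarith
    _ = ∫ q, V q.1 q.2 ∂(P.prod G) := (integral_prod _ hV).symm

lemma integral_sum_sq_pi {X : Type*} [MeasurableSpace X] {Q : Measure X} [IsProbabilityMeasure Q]
    {f : X → ℝ} (hf : MemLp f 2 Q) (h0 : ∫ x, f x ∂Q = 0) (n : ℕ) :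
    Integrable (fun w => (∑ k, f (w k)) ^ 2) (Measure.pi fun _ : Fin n => Q) ∧
      ∫ w, (∑ k, f (w k)) ^ 2 ∂(Measure.pi fun _ : Fin n => Q) = n * ∫ x, f x ^ 2 ∂Q := by
  have he := fun k : Fin n => measurePreserving_eval (fun _ : Fin n => Q) k
  have hk : ∀ k : Fin n, MemLp (fun w : Fin n → X => f (w k)) 2 (Measure.pi fun _ : Fin n => Q) :=
    fun k => hf.comp_measurePreserving (he k)
  have hS : MemLp (fun w : Fin n → X => ∑ k, f (w k)) 2 (Measure.pi fun _ : Fin n => Q) :=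
    memLp_finsetSum _ fun k _ => hk k
  refine ⟨hS.integrable_sq, ?_⟩
  have h := variance_sum_pi (μ := fun _ : Fin n => Q) (X := fun _ => f) fun _ => hf
  rw [Finset.sum_const, Finset.card_univ, Fintype.card_fin, nsmul_eq_mul,
    variance_of_integral_eq_zero hf.aestronglyMeasurable.aemeasurable h0] at h
  rw [← h, ← variance_of_integral_eq_zero hS.aestronglyMeasurable.aemeasurable]
  · congr 1
    ext w
    simp
  · rw [integral_finsetSum _ fun k _ => (hk k).integrable one_le_two]
    refine Finset.sum_eq_zero fun k _ => ?_
    have e := integral_map (he k).aemeasurable (f := f)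
      ((he k).map_eq.symm ▸ hf.aestronglyMeasurable)
    rw [(he k).map_eq, h0] at e
    exact e.symm

lemma sum_transpose_mulVec_dotProduct_le {d l n : ℕ} {A : Matrix (Fin d) (Fin l) ℝ}
    (hA : fnorm A = 1) (w : Fin n → (Fin d → ℝ) × (Fin l → ℝ)) {a : ℝ} (ha : 0 < a) :
    ∑ k, ((Aᵀ *ᵥ (w k).1) ⬝ᵥ (w k).2) ≤
      (a + (∑ i, ∑ j, (∑ k, (w k).1 j * (w k).2 i) ^ 2) / a) / 2 := by
  calc ∑ k, ((Aᵀ *ᵥ (w k).1) ⬝ᵥ (w k).2)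
      = ∑ i, ∑ j, A j i * ∑ k, (w k).1 j * (w k).2 i := by
        simp only [dotProduct, transpose_mulVec_apply, Finset.sum_mul, Finset.mul_sum]
        rw [Finset.sum_comm]
        refine Finset.sum_congr rfl fun i _ => ?_
        rw [Finset.sum_comm]
        simp only [mul_assoc]
    _ ≤ ∑ i, ∑ j, (a * A j i ^ 2 + (∑ k, (w k).1 j * (w k).2 i) ^ 2 / a) / 2 := by
        refine Finset.sum_le_sum fun i _ => Finset.sum_le_sum fun j _ => ?_
        set M := ∑ k, (w k).1 j * (w k).2 i
        have h : 0 ≤ (a * A j i - M) ^ 2 / a := by positivity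
        have e : (a * A j i - M) ^ 2 / a = a * A j i ^ 2 - 2 * (A j i * M) + M ^ 2 / a := by
          field_simp
          ring
        linarith
    _ = _ := by
        simp only [← Finset.sum_div, Finset.sum_add_distrib, ← Finset.mul_sum]
        rw [sum_sq_of_fnorm_eq_one hA, mul_one]

lemma integral_supWalk_dotProduct_le {ι : Type*} [Countable ι] [Nonempty ι] {d l n : ℕ}
    {v : NNReal} (hv : (d : ℝ) * v = 1) (hn : 0 < n) (hl : 0 < l)
    (D : ι → Matrix (Fin d) (Fin l) ℝ) (hD : ∀ i, fnorm (D i) = 1) {c : ℝ} (hc : 0 ≤ c)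
    (hi : Integrable (supWalk (fun i (p : (Fin d → ℝ) × (Fin l → ℝ)) =>
      c * (((D i)ᵀ *ᵥ p.1) ⬝ᵥ p.2)) 0 : (Fin n → _) → ℝ)
      (Measure.pi fun _ => (gaussianVec d v).prod (gaussianVec l 1))) :
    ∫ w, supWalk (fun i (p : (Fin d → ℝ) × (Fin l → ℝ)) => c * (((D i)ᵀ *ᵥ p.1) ⬝ᵥ p.2)) 0 w
      ∂(Measure.pi fun _ : Fin n => (gaussianVec d v).prod (gaussianVec l 1)) ≤
        c * √(n * l) := by
  set Q := (gaussianVec d v).prod (gaussianVec l 1)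
  have hnl : (0 : ℝ) < n * l := by positivity
  set a := √((n : ℝ) * l)
  have ha : 0 < a := Real.sqrt_pos.2 hnl
  have haa : a * a = n * l := Real.mul_self_sqrt hnl.le
  have hf2 : ∀ i j, Integrable (fun p : (Fin d → ℝ) × (Fin l → ℝ) => p.1 j ^ 2 * p.2 i ^ 2) Q :=
    fun i j => (integral_eval_sq_gaussianVec v j).1.mul_prod (integral_eval_sq_gaussianVec 1 i).1
  have hf : ∀ i j, MemLp (fun p : (Fin d → ℝ) × (Fin l → ℝ) => p.1 j * p.2 i) 2 Q :=
    fun i j => (memLp_two_iff_integrable_sq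
      (Measurable.aestronglyMeasurable (by fun_prop))).2 (by simpa only [mul_pow] using hf2 i j)
  have hM := fun i j => integral_sum_sq_pi (hf i j) (by
    rw [integral_prod_mul (fun z : Fin d → ℝ => z j) (fun g : Fin l → ℝ => g i),
      integral_eval_gaussianVec, zero_mul]) n
  have hM2 : ∀ i j, ∫ w, (∑ k, (w k).1 j * (w k).2 i) ^ 2 ∂(Measure.pi fun _ : Fin n => Q) =
      n * v := fun i j => by
    rw [(hM i j).2]
    simp only [mul_pow]
    rw [integral_prod_mul (fun z : Fin d → ℝ => z j ^ 2) (fun g : Fin l → ℝ => g i ^ 2),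
      (integral_eval_sq_gaussianVec v j).2, (integral_eval_sq_gaussianVec 1 i).2]
    simp
  have hMi := integrable_finsetSum (μ := Measure.pi fun _ : Fin n => Q) Finset.univ
    fun i _ => integrable_finsetSum Finset.univ fun j _ => (hM i j).1
  calc ∫ w, supWalk (fun i (p : (Fin d → ℝ) × (Fin l → ℝ)) => c * (((D i)ᵀ *ᵥ p.1) ⬝ᵥ p.2)) 0 w
      ∂(Measure.pi fun _ : Fin n => Q)
      ≤ ∫ w, c * ((a + (∑ i, ∑ j, (∑ k, (w k).1 j * (w k).2 i) ^ 2) / a) / 2)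
          ∂(Measure.pi fun _ : Fin n => Q) := by
        refine integral_mono hi
          ((((integrable_const a).add (hMi.div_const a)).div_const 2).const_mul c) fun w => ?_
        refine ciSup_le fun i => ?_
        simp only [Pi.zero_apply, zero_add, ← Finset.mul_sum]
        exact mul_le_mul_of_nonneg_left (sum_transpose_mulVec_dotProduct_le (hD i) w ha) hc
    _ = c * ((a + (l * (d * (n * v))) / a) / 2) := by
        rw [integral_const_mul, integral_div, integral_add (integrable_const a) (hMi.div_const a),
          integral_div, integral_finsetSum _ fun i _ =>
            integrable_finsetSum Finset.univ fun j _ => (hM i j).1]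
        simp_rw [integral_finsetSum _ fun j _ => (hM _ j).1, hM2]
        simp
    _ = c * a := by
        rw [show (l : ℝ) * (d * (n * v)) = a * a * (d * v) by rw [haa]; ring, hv]
        field_simp
        ring

section InlierProcess

variable {ι : Type*} [Countable ι] [Nonempty ι] {d l n : ℕ} {v : NNReal}
  {D : ι → Matrix (Fin d) (Fin l) ℝ}

lemma integrable_supWalk_neg_vnorm (hD : ∀ i, fnorm (D i) = 1) :
    Integrable (supWalk (fun i x => -vnorm ((D i)ᵀ *ᵥ x)) 0 : (Fin n → _) → ℝ)
      (Measure.pi fun _ => gaussianVec d v) :=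
  integrable_supWalk (B := vnorm) (r := 0) (fun i => (measurable_vnorm_mulVec _).neg)
    (integrable_vnorm d v)
    (fun i x => by
      rw [Pi.neg_apply, abs_neg, abs_of_nonneg (vnorm_nonneg _)]
      exact vnorm_transpose_mulVec_le (hD i) x)
    (fun i => by simp) n

lemma integral_supWalk_neg_vnorm_le (hv : (d : ℝ) * v = 1) (hn : 0 < n) (hl : 0 < l)
    (hD : ∀ i, fnorm (D i) = 1) :
    ∫ z, supWalk (fun i x => -vnorm ((D i)ᵀ *ᵥ x)) 0 z
      ∂(Measure.pi fun _ : Fin n => gaussianVec d v) ≤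
        √(2 * Real.pi) * √(n * l) - n * (√(2 / Real.pi) * √v) := by
  set P := gaussianVec d v
  set Q := P.prod (gaussianVec l 1)
  set c := √(2 * Real.pi)
  have hc : 0 ≤ c := Real.sqrt_nonneg _
  set μ : ι → ℝ := fun i => ∫ y, vnorm ((D i)ᵀ *ᵥ y) ∂P
  set Φ : ι → (Fin d → ℝ) → ℝ := fun i x => μ i - vnorm ((D i)ᵀ *ᵥ x)
  set Ψ : ι → (Fin d → ℝ) × (Fin l → ℝ) → ℝ := fun i p => c * (((D i)ᵀ *ᵥ p.1) ⬝ᵥ p.2)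
  have hNB : ∀ i x, vnorm ((D i)ᵀ *ᵥ x) ≤ vnorm x := fun i x => vnorm_transpose_mulVec_le (hD i) x
  have hBi : Integrable vnorm P := integrable_vnorm d v
  have hΦm : ∀ i, Measurable (Φ i) := fun i => measurable_const.sub (measurable_vnorm_mulVec _)
  have hΨm : ∀ i, Measurable (Ψ i) := fun i => by
    simp only [Ψ, dotProduct, Matrix.mulVec]
    fun_prop
  have hμ : ∀ i, |μ i| ≤ ∫ x, vnorm x ∂P := fun i => by
    rw [abs_of_nonneg (integral_nonneg fun _ => vnorm_nonneg _)]
    exact integral_mono (integrable_vnorm_transpose_mulVec v (hD i)) hBi (hNB i)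
  have hΦB : ∀ i x, |Φ i x| ≤ ∫ x, vnorm x ∂P + vnorm x := fun i x => by
    refine (abs_sub _ _).trans (add_le_add (hμ i) ?_)
    rw [abs_of_nonneg (vnorm_nonneg _)]
    exact hNB i x
  have hΨB : ∀ i p, |Ψ i p| ≤ c * (vnorm p.1 * vnorm p.2) := fun i p => by
    rw [abs_mul, abs_of_nonneg hc]
    gcongr
    refine (abs_dotProduct_le_vnorm_mul _ _).trans ?_
    gcongr
    · exact vnorm_nonneg _
    · exact hNB i _
  have hΦi : Integrable (fun x => ∫ x, vnorm x ∂P + vnorm x) P := (integrable_const _).add hBi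
  have hΨi : Integrable (fun p : (Fin d → ℝ) × (Fin l → ℝ) => c * (vnorm p.1 * vnorm p.2)) Q :=
    (hBi.mul_prod (integrable_vnorm l 1)).const_mul c
  have h0 : ∀ i : ι, |(0 : ι → ℝ) i| ≤ 0 := fun i => by simp
  have hi := integrable_supWalk hΦm hΦi hΦB h0 n
  calc ∫ z, supWalk (fun i x => -vnorm ((D i)ᵀ *ᵥ x)) 0 z ∂(Measure.pi fun _ : Fin n => P)
      ≤ ∫ z, (supWalk Φ 0 z - n * (√(2 / Real.pi) * √v)) ∂(Measure.pi fun _ : Fin n => P) := by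
        refine integral_mono (integrable_supWalk_neg_vnorm hD) (hi.sub (integrable_const _))
          fun z => ciSup_le fun i => ?_
        have h1 := le_ciSup (bddAbove_range_of_abs_le fun i => abs_add_sum_le hΦB h0 z i) i
        have h2 : (n : ℝ) * (√(2 / Real.pi) * √v) ≤ n * μ i := by
          gcongr
          exact le_integral_vnorm_transpose_mulVec v (hD i)
        simp only [Φ, Finset.sum_sub_distrib, Finset.sum_const, Finset.card_univ, Fintype.card_fin,
          nsmul_eq_mul] at h1
        rw [Finset.sum_neg_distrib]
        change _ ≤ (⨆ i, _) - _
        simp only [Φ, Finset.sum_sub_distrib, Finset.sum_const, Finset.card_univ, Fintype.card_fin,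
          nsmul_eq_mul]
        linarith
    _ = ∫ z, supWalk Φ 0 z ∂(Measure.pi fun _ : Fin n => P) - n * (√(2 / Real.pi) * √v) := by
        rw [integral_sub hi (integrable_const _)]
        simp
    _ ≤ ∫ w, supWalk Ψ 0 w ∂(Measure.pi fun _ : Fin n => Q) - n * (√(2 / Real.pi) * √v) := by
        gcongr
        exact integral_supWalk_mono hΦm hΨm hΦi hΨi hΦB hΨB
          (fun R r hR => integral_iSup_sub_vnorm_le v D hD R r hR) n 0 0 h0
    _ ≤ _ := by
        gcongr
        exact integral_supWalk_dotProduct_le hv hn hl D hD hc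
          (integrable_supWalk hΨm hΨi hΨB h0 n)

lemma measure_le_supWalk_neg_vnorm_le (hn : 0 < n) (hD : ∀ i, fnorm (D i) = 1) (hv : 0 < v)
    {t : ℝ} (ht : 0 ≤ t) :
    (Measure.pi fun _ : Fin n => gaussianVec d v).real
        {z | ∫ z, supWalk (fun i x => -vnorm ((D i)ᵀ *ᵥ x)) 0 z
              ∂(Measure.pi fun _ : Fin n => gaussianVec d v) + t ≤
            supWalk (fun i x => -vnorm ((D i)ᵀ *ᵥ x)) 0 z} ≤
      Real.exp (-(t ^ 2 / (2 * n * v))) := by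
  set W : (Fin n → Fin d → ℝ) → ℝ := supWalk (fun i x => -vnorm ((D i)ᵀ *ᵥ x)) 0
  set M := Measure.pi fun _ : Fin n => gaussianVec d v
  have hvr : (0 : ℝ) < v := hv
  have hnr : (0 : ℝ) < n := by exact_mod_cast hn
  set s := t / (n * v)
  have hs : 0 ≤ s := by positivity
  have hW0 : ∀ z, W z ≤ 0 := fun z => ciSup_le fun i => by
    simp only [Pi.zero_apply, zero_add, Finset.sum_neg_distrib, Left.neg_nonpos_iff]
    exact Finset.sum_nonneg fun k _ => vnorm_nonneg _
  have hWm : Measurable W := measurable_supWalk fun i => (measurable_vnorm_mulVec _).neg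
  have hint : Integrable (fun z => Real.exp (s * W z)) M := by
    refine (integrable_const (1 : ℝ)).mono' (by fun_prop) (.of_forall fun z => ?_)
    rw [Real.norm_of_nonneg (Real.exp_nonneg _)]
    exact Real.exp_le_one_iff.2 (mul_nonpos_of_nonneg_of_nonpos hs (hW0 z))
  have h := measure_ge_le_exp_mul_mgf (∫ z, W z ∂M + t) hs hint
  have h2 : mgf W M s ≤ _ := integral_exp_supWalk_le (B := vnorm) (v := v) hs
    (fun i => measurable_vnorm_mulVec (D i)ᵀ) (integrable_vnorm d v)
    (integral_vnorm_sq_gaussianVec d v).1 (fun i x => vnorm_nonneg _)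
    (fun i x => vnorm_transpose_mulVec_le (hD i) x)
    (fun i => (integral_vnorm_sq_transpose_mulVec v (hD i)).le) n 0 0 (fun i => by simp)
  refine h.trans ((mul_le_mul_of_nonneg_left h2 (Real.exp_nonneg _)).trans_eq ?_)
  rw [← Real.exp_add]
  congr 1
  change -s * (∫ z, W z ∂M + t) + (s * ∫ z, W z ∂M + n * (s ^ 2 * v / 2)) = _
  simp only [s]
  field_simp
  ring

end InlierProcess

lemma exists_countable_dense_fnorm_eq_one {d l : ℕ} (hd : 0 < d) (hl : 0 < l) :
    ∃ D : ℕ → {A : Matrix (Fin d) (Fin l) ℝ // fnorm A = 1}, DenseRange D := by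
  have : SecondCountableTopology (Matrix (Fin d) (Fin l) ℝ) :=
    inferInstanceAs (SecondCountableTopology (Fin d → Fin l → ℝ))
  have : Nonempty {A : Matrix (Fin d) (Fin l) ℝ // fnorm A = 1} := by
    refine ⟨⟨Matrix.single ⟨0, hd⟩ ⟨0, hl⟩ 1, ?_⟩⟩
    simp [fnorm]
  have : SecondCountableTopology {A : Matrix (Fin d) (Fin l) ℝ // fnorm A = 1} :=
    Topology.IsInducing.subtypeVal.secondCountableTopology
  exact ⟨_, TopologicalSpace.denseRange_denseSeq _⟩

/-- Haystack model, inlier bound. With independent inlier coefficient vectors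
zᵢ ~ N(0,(1/d)I_d), c ≥ √(2/(dπ)) − √(8ℓ/m₁) − c₁/√m₁ with probability at least
1 − 2exp(−c₁²d/2). -/
theorem haystack_inlier_bound (d m₁ ℓ : ℕ) (hd : 1 ≤ d) (hm₁ : 1 ≤ m₁) (hℓ : 1 ≤ ℓ)
    (c₁ : ℝ) (hc₁ : 0 < c₁) :
    ENNReal.ofReal (1 - 2 * Real.exp (-(c₁ ^ 2 * (d : ℝ)) / 2)) ≤
      (Measure.pi fun _ : Fin m₁ => gaussianVec d (1 / (d : NNReal)))
        {ω | Real.sqrt (2 / ((d : ℝ) * Real.pi)) - Real.sqrt (8 * (ℓ : ℝ) / (m₁ : ℝ))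
                - c₁ / Real.sqrt (m₁ : ℝ)
              ≤ (1 / (m₁ : ℝ)) * sInf {t | ∃ D : Matrix (Fin d) (Fin ℓ) ℝ,
                  fnorm D = 1 ∧ t = ∑ i, vnorm (Dᵀ *ᵥ ω i)}} := by
  set v : NNReal := 1 / (d : NNReal)
  set M := Measure.pi fun _ : Fin m₁ => gaussianVec d v
  have hd0 : (0 : ℝ) < d := by exact_mod_cast hd
  have hm0 : (0 : ℝ) < m₁ := by exact_mod_cast hm₁
  have hvd : (v : ℝ) = 1 / d := by simp [v]
  have hv0 : 0 < v := by
    rw [← NNReal.coe_pos, hvd]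
    positivity
  have hdv : (d : ℝ) * v = 1 := by
    rw [hvd]
    field_simp
  obtain ⟨D, hDd⟩ := exists_countable_dense_fnorm_eq_one hd hℓ
  have hD : ∀ i, fnorm (D i).1 = 1 := fun i => (D i).2
  set W : (Fin m₁ → Fin d → ℝ) → ℝ := supWalk (fun i x => -vnorm ((D i).1ᵀ *ᵥ x)) 0
  have hWm : Measurable W := measurable_supWalk fun i => (measurable_vnorm_mulVec _).neg
  set t := c₁ * √(m₁ : ℝ)
  have hms : 0 < √(m₁ : ℝ) := Real.sqrt_pos.2 hm0
  have hmm : √(m₁ : ℝ) * √(m₁ : ℝ) = m₁ := Real.mul_self_sqrt hm0.le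
  have hmean : ∫ z, W z ∂M ≤ √(8 * ℓ / m₁) * m₁ - m₁ * √(2 / (d * Real.pi)) := by
    refine (integral_supWalk_neg_vnorm_le hdv hm₁ hℓ hD).trans (sub_le_sub ?_ (le_of_eq ?_))
    · rw [← Real.sqrt_mul (by positivity)]
      refine Real.sqrt_le_iff.2 ⟨by positivity, ?_⟩
      rw [mul_pow, Real.sq_sqrt (by positivity),
        show 8 * (ℓ : ℝ) / m₁ * (m₁ : ℝ) ^ 2 = 2 * 4 * (m₁ * ℓ) by field_simp; ring]
      gcongr
      exact Real.pi_le_four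
    · rw [← Real.sqrt_mul (by positivity), hvd]
      congr 2
      field_simp
  have htail : M.real {z | ∫ z, W z ∂M + t ≤ W z} ≤ Real.exp (-(c₁ ^ 2 * (d : ℝ)) / 2) := by
    refine (measure_le_supWalk_neg_vnorm_le hm₁ hD hv0 (by positivity)).trans_eq ?_
    congr 1
    simp only [t, mul_pow, hvd, Real.sq_sqrt hm0.le]
    field_simp
  have hms' : MeasurableSet {z | ∫ z, W z ∂M + t ≤ W z} := measurableSet_le (by fun_prop) hWm
  calc ENNReal.ofReal (1 - 2 * Real.exp (-(c₁ ^ 2 * (d : ℝ)) / 2))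
      ≤ ENNReal.ofReal (M.real {z | ∫ z, W z ∂M + t ≤ W z}ᶜ) := by
        refine ENNReal.ofReal_le_ofReal ?_
        rw [probReal_compl_eq_one_sub hms']
        linarith [Real.exp_pos (-(c₁ ^ 2 * (d : ℝ)) / 2)]
    _ = M {z | ∫ z, W z ∂M + t ≤ W z}ᶜ := ofReal_measureReal
    _ ≤ _ := measure_mono fun ω hω => ?_
  simp only [Set.mem_compl_iff, Set.mem_ofPred_eq, not_le] at hω ⊢
  set b := m₁ * √(2 / (d * Real.pi)) - √(8 * ℓ / m₁) * m₁ - t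
  have hseq : ∀ i, b ≤ ∑ k, vnorm ((D i).1ᵀ *ᵥ ω k) := fun i => by
    have h1 : 0 + ∑ k, -vnorm ((D i).1ᵀ *ᵥ ω k) ≤ W ω :=
      le_ciSup (bddAbove_range_of_abs_le (abs_add_sum_le (B := vnorm) (r := 0) (R := 0)
        (Φ := fun i x => -vnorm ((D i).1ᵀ *ᵥ x))
        (fun i x => by
          rw [abs_neg, abs_of_nonneg (vnorm_nonneg _)]
          exact vnorm_transpose_mulVec_le (hD i) x)
        (fun i => by simp) ω)) i
    rw [Finset.sum_neg_distrib] at h1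
    linarith
  have hall : ∀ A : {A : Matrix (Fin d) (Fin ℓ) ℝ // fnorm A = 1},
      b ≤ ∑ k, vnorm (A.1ᵀ *ᵥ ω k) := fun A => by
    refine hDd.induction_on A ?_ hseq
    refine isClosed_le continuous_const (continuous_finsetSum _ fun k _ => ?_)
    exact continuous_vnorm.comp
      (Continuous.matrix_mulVec continuous_subtype_val.matrix_transpose continuous_const)
  calc √(2 / (d * Real.pi)) - √(8 * ℓ / m₁) - c₁ / √m₁ = 1 / m₁ * b := by
        simp only [b, t]
        have h3 : c₁ / √(m₁ : ℝ) = c₁ * √(m₁ : ℝ) / m₁ := by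
          rw [div_eq_div_iff hms.ne' hm0.ne', mul_assoc, hmm]
        rw [h3]
        field_simp
    _ ≤ _ := by
        gcongr
        refine le_csInf ⟨_, (D 0).1, hD 0, rfl⟩ ?_
        rintro _ ⟨A, hA, rfl⟩
        exact hall ⟨A, hA⟩

end
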